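/- Let H0 be a hierarchy on [n] with induced triplet set T0, and let T be the random subset of T0 in which, independently for each pair of triplets {(i,j,k),(j,i,k)} ⊆ T0 with i<j, both triplets are included with probability p ∈ (0,1]. Let Ĥ be any hierarchy maximizing Trev(H, T) over all hierarchies H on [n]. For any constants α > 0 and 0 < ε < 1/2, if n > 8/ε and p > 2¹²·(α+2)·log n / (n·ε²), then with probability at least 1 − 2n^{−α}, both 0.1·p·n³ ≤ |T| ≤ 0.5·p·n³ and Trev(Ĥ, T0) ≥ (1−ε)·Trev(H0, T0) hold. -/

import Mathlib

open Finset MeasureTheory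

namespace CompHC

/-- A rooted binary tree with leaves labelled by elements of `Fin n`. -/
inductive HTree (n : ℕ) : Type
  | leaf (i : Fin n) : HTree n
  | node (l r : HTree n) : HTree n

namespace HTree

/-- The list of leaf labels of a tree. -/
def leaves {n : ℕ} : HTree n → List (Fin n)
  | .leaf i => [i]
  | .node l r => l.leaves ++ r.leaves

/-- The number of leaves of a tree. -/
def size {n : ℕ} (t : HTree n) : ℕ := t.leaves.length

/-- `|H(i ∨ j)|`: the number of leaves of the smallest subtree containing both `i` and `j`. -/
def lcaSize {n : ℕ} : HTree n → Fin n → Fin n → ℕ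
  | .leaf _, _, _ => 1
  | .node l r, i, j =>
      if i ∈ l.leaves ∧ j ∈ l.leaves then l.lcaSize i j
      else if i ∈ r.leaves ∧ j ∈ r.leaves then r.lcaSize i j
      else l.size + r.size

/-- Sum of `f |N1| |N2|` over the internal nodes `N` of the tree, `N1, N2` its children. -/
def internalSum {n : ℕ} (f : ℕ → ℕ → ℕ) : HTree n → ℕ
  | .leaf _ => 0
  | .node l r => f l.size r.size + l.internalSum f + r.internalSum f

end HTree

/-- A hierarchy on `[n]`: every object appears exactly once as a leaf. -/
def IsHierarchy {n : ℕ} (t : HTree n) : Prop :=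
  t.leaves.Nodup ∧ ∀ i : Fin n, i ∈ t.leaves

abbrev Triplet (n : ℕ) := Fin n × Fin n × Fin n
abbrev Quadruplet (n : ℕ) := Fin n × Fin n × Fin n × Fin n

/-- The entries of a triplet are pairwise distinct. -/
def distinctTriplet {n : ℕ} (t : Triplet n) : Prop :=
  t.1 ≠ t.2.1 ∧ t.1 ≠ t.2.2 ∧ t.2.1 ≠ t.2.2

/-- A quadruplet `(i,j,k,l)` satisfies `i<j`, `k<l`, `(i,j) ≠ (k,l)`. -/
def validQuadruplet {n : ℕ} (q : Quadruplet n) : Prop :=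
  q.1 < q.2.1 ∧ q.2.2.1 < q.2.2.2 ∧ (q.1, q.2.1) ≠ (q.2.2.1, q.2.2.2)

/-- Triplet revenue `Trev(H,T) = Σ_{(i,j,k)∈T} (|H(i∨k)| − |H(i∨j)|)`. -/
def Trev {n : ℕ} (H : HTree n) (T : Finset (Triplet n)) : ℤ :=
  ∑ t ∈ T, ((H.lcaSize t.1 t.2.2 : ℤ) - (H.lcaSize t.1 t.2.1 : ℤ))

/-- Quadruplet revenue `Qrev(H,Q) = Σ_{(i,j,k,l)∈Q} (|H(k∨l)| − |H(i∨j)|)`. -/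
def Qrev {n : ℕ} (H : HTree n) (Q : Finset (Quadruplet n)) : ℤ :=
  ∑ q ∈ Q, ((H.lcaSize q.2.2.1 q.2.2.2 : ℤ) - (H.lcaSize q.1 q.2.1 : ℤ))

/-- The set of pairs `(i,j)` with `i < j`. -/
def pairs (n : ℕ) : Finset (Fin n × Fin n) :=
  Finset.univ.filter fun p => p.1 < p.2

/-- Dasgupta's cost `Dcost(H,s) = Σ_{i<j} s_{ij}·|H(i∨j)|`. -/
noncomputable def Dcost {n : ℕ} (H : HTree n) (s : Fin n → Fin n → ℝ) : ℝ :=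
  ∑ p ∈ pairs n, s p.1 p.2 * (H.lcaSize p.1 p.2 : ℝ)

/-- The AddS3 similarity computed from a triplet set. -/
def sAddS3 {n : ℕ} (T : Finset (Triplet n)) (i j : Fin n) : ℤ :=
  ∑ k ∈ Finset.univ.filter (fun k : Fin n => k ≠ i ∧ k ≠ j),
    (((if (i, j, k) ∈ T then 1 else 0) - (if (i, k, j) ∈ T then 1 else 0)
      + (if (j, i, k) ∈ T then 1 else 0) - (if (j, k, i) ∈ T then 1 else 0) : ℤ))

/-- The AddS4 similarity computed from a quadruplet set. -/
def sAddS4 {n : ℕ} (Q : Finset (Quadruplet n)) (i j : Fin n) : ℤ :=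
  ∑ p ∈ (pairs n).filter (fun p => p ≠ (i, j)),
    (((if (i, j, p.1, p.2) ∈ Q then 1 else 0)
      - (if (p.1, p.2, i, j) ∈ Q then 1 else 0) : ℤ))

/-- The triplet set induced by a hierarchy `H0`:
`T0 = {(i,j,k) : i,j,k pairwise distinct, |H0(i∨j)| < min(|H0(i∨k)|, |H0(j∨k)|)}`. -/
def inducedTriplets {n : ℕ} (H : HTree n) : Finset (Triplet n) :=
  Finset.univ.filter fun t : Triplet n =>
    t.1 ≠ t.2.1 ∧ t.1 ≠ t.2.2 ∧ t.2.1 ≠ t.2.2 ∧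
    H.lcaSize t.1 t.2.1 < min (H.lcaSize t.1 t.2.2) (H.lcaSize t.2.1 t.2.2)


/-- Bernoulli measure on `Bool` with success probability `p`. -/
noncomputable def bern (p : ℝ) : Measure Bool :=
  (ENNReal.ofReal p) • Measure.dirac true + (ENNReal.ofReal (1 - p)) • Measure.dirac false

/-- Product measure of i.i.d. Bernoulli(p) coins, one for each pair of triplets
`{(i,j,k),(j,i,k)}` (indexed by triplets; only keys `(i,j,k)` with `i ≤ j` are used). -/
noncomputable def sampleMeasure (n : ℕ) (p : ℝ) : Measure (Triplet n → Bool) :=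
  Measure.pi fun _ => bern p

/-- The common key of the pair of triplets `{(i,j,k),(j,i,k)}`. -/
def pairKey {n : ℕ} (t : Triplet n) : Triplet n := (min t.1 t.2.1, max t.1 t.2.1, t.2.2)

/-- The random subset `T ⊆ T0`: the pair `{(i,j,k),(j,i,k)}` is included iff its coin is true. -/
def sampledT {n : ℕ} (H0 : HTree n) (ω : Triplet n → Bool) : Finset (Triplet n) :=
  (inducedTriplets H0).filter fun t => ω (pairKey t) = true

/-- The key of the flipping coin `ζ^i_{jk}` for the triplets `(i,j,k)` and `(i,k,j)`. -/
def flipKey {n : ℕ} (t : Triplet n) : Triplet n := (t.1, min t.2.1 t.2.2, max t.2.1 t.2.2)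

/-- Flipping a triplet: `(i,j,k) ↦ (i,k,j)`. -/
def flipTriplet {n : ℕ} (t : Triplet n) : Triplet n := (t.1, t.2.2, t.2.1)

/-- Product measure: independent Bernoulli(p) sampling coins (left index) and
Bernoulli(δ) flipping coins (right index). -/
noncomputable def noisyMeasure (n : ℕ) (p δ : ℝ) :
    Measure ((Triplet n ⊕ Triplet n) → Bool) :=
  Measure.pi fun idx => Sum.elim (fun _ : Triplet n => bern p) (fun _ : Triplet n => bern δ) idx

/-- The noisy random triplet set `T'`: sample pairs from `T0` with probability `p`, then flip
each sampled triplet `(i,j,k)` to `(i,k,j)` independently with probability `δ`. -/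
def noisySampledT {n : ℕ} (H0 : HTree n) (ω : (Triplet n ⊕ Triplet n) → Bool) :
    Finset (Triplet n) :=
  ((inducedTriplets H0).filter fun t => ω (Sum.inl (pairKey t)) = true).image
    fun t => if ω (Sum.inr (flipKey t)) = true then flipTriplet t else t

namespace HTree

variable {n : ℕ}

lemma size_pos (t : HTree n) : 0 < t.size := by
  induction t with
  | leaf i => simp [size, leaves]
  | node l r ihl ihr => simp only [size, leaves, List.length_append] at *; omega

lemma lcaSize_pos (t : HTree n) (i j : Fin n) : 0 < t.lcaSize i j := by
  induction t with
  | leaf i => simp [lcaSize]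
  | node l r ihl ihr =>
    have := l.size_pos
    simp only [lcaSize]
    split_ifs <;> omega

lemma lcaSize_le_size (t : HTree n) (i j : Fin n) : t.lcaSize i j ≤ t.size := by
  induction t with
  | leaf i => simp [lcaSize, size, leaves]
  | node l r ihl ihr =>
    have : (node l r).size = l.size + r.size := by simp [size, leaves]
    simp only [lcaSize]
    split_ifs <;> omega

lemma lcaSize_comm (t : HTree n) (i j : Fin n) : t.lcaSize i j = t.lcaSize j i := by
  induction t with
  | leaf i => rfl
  | node l r ihl ihr =>
    simp only [lcaSize, ihl, ihr, and_comm]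

lemma lcaSize_self {t : HTree n} {i : Fin n} (hi : i ∈ t.leaves) : t.lcaSize i i = 1 := by
  induction t with
  | leaf i => rfl
  | node l r ihl ihr =>
    simp only [leaves, List.mem_append] at hi
    simp only [lcaSize, and_self]
    split_ifs with h1 h2
    · exact ihl h1
    · exact ihr h2
    · tauto

/-- Among three leaves `i ≠ j` and `k`, exactly one pair has the smallest common subtree and the two
other pairs share theirs. -/
lemma lcaSize_trichotomy {t : HTree n} (ht : t.leaves.Nodup) {i j k : Fin n}
    (hi : i ∈ t.leaves) (hj : j ∈ t.leaves) (hk : k ∈ t.leaves)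
    (hij : i ≠ j) :
    (t.lcaSize i j < t.lcaSize i k ∧ t.lcaSize j k = t.lcaSize i k) ∨
    (t.lcaSize j k < t.lcaSize i j ∧ t.lcaSize i j = t.lcaSize i k) ∨
    (t.lcaSize i k < t.lcaSize i j ∧ t.lcaSize i j = t.lcaSize j k) := by
  induction t with
  | leaf a => simp_all [leaves]
  | node l r ihl ihr =>
    simp only [leaves, List.mem_append, List.nodup_append'] at hi hj hk ht
    obtain ⟨hl, hr, hd⟩ := ht
    have hli : ∀ x, x ∈ l.leaves → x ∉ r.leaves := fun x h h' => hd h h'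
    have h3 := l.size_pos
    have h4 := r.size_pos
    have hi' := hli i
    have hj' := hli j
    have hk' := hli k
    have a1 := l.lcaSize_le_size i j
    have a2 := l.lcaSize_le_size i k
    have a3 := l.lcaSize_le_size j k
    have b1 := r.lcaSize_le_size i j
    have b2 := r.lcaSize_le_size i k
    have b3 := r.lcaSize_le_size j k
    by_cases i1 : i ∈ l.leaves <;> by_cases j1 : j ∈ l.leaves <;> by_cases k1 : k ∈ l.leaves <;>
      simp_all only [lcaSize, and_true, and_false, if_true, if_false, false_or, or_false,
        not_true, not_false_iff, forall_const, false_imp_iff] <;> omega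

lemma card_leaves {t : HTree n} (ht : t.leaves.Nodup) : t.leaves.toFinset.card = t.size :=
  List.toFinset_card_of_nodup ht

lemma lcaSize_node_left {l r : HTree n} {i j : Fin n} (hi : i ∈ l.leaves) (hj : j ∈ l.leaves) :
    (node l r).lcaSize i j = l.lcaSize i j := by
  simp [lcaSize, hi, hj]

lemma lcaSize_node_right {l r : HTree n} (hd : List.Disjoint l.leaves r.leaves) {i j : Fin n}
    (hi : i ∈ r.leaves) (hj : j ∈ r.leaves) :
    (node l r).lcaSize i j = r.lcaSize i j := by
  have : i ∉ l.leaves := fun h => hd h hi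
  simp [lcaSize, hi, hj, this]

lemma lcaSize_node_cross {l r : HTree n} (hd : List.Disjoint l.leaves r.leaves) {i j : Fin n}
    (hi : i ∈ l.leaves) (hj : j ∈ r.leaves) :
    (node l r).lcaSize i j = l.size + r.size := by
  have h1 : j ∉ l.leaves := fun h => hd h hj
  have h2 : i ∉ r.leaves := fun h => hd hi h
  simp [lcaSize, h1, h2]

lemma lcaSize_node_cross' {l r : HTree n} (hd : List.Disjoint l.leaves r.leaves) {i j : Fin n}
    (hi : i ∈ r.leaves) (hj : j ∈ l.leaves) :
    (node l r).lcaSize i j = l.size + r.size := by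
  rw [lcaSize_comm, lcaSize_node_cross hd hj hi]

lemma disjoint_toFinset {l r : HTree n} (hd : List.Disjoint l.leaves r.leaves) :
    Disjoint l.leaves.toFinset r.leaves.toFinset :=
  List.disjoint_toFinset_iff_disjoint.mpr hd

lemma leaves_node_toFinset (l r : HTree n) :
    (node l r).leaves.toFinset = l.leaves.toFinset ∪ r.leaves.toFinset := by
  simp [leaves, List.toFinset_append]

/-- The total size of all common subtrees depends only on the number of leaves. -/
lemma sum_lcaSize {t : HTree n} (ht : t.leaves.Nodup) :
    ∑ i ∈ t.leaves.toFinset, ∑ j ∈ t.leaves.toFinset, (t.lcaSize i j : ℝ) =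
      (2 * (t.size : ℝ) ^ 3 + t.size) / 3 := by
  induction t with
  | leaf a => simp [leaves, lcaSize, size]; norm_num
  | node l r ihl ihr =>
    simp only [leaves, List.nodup_append'] at ht
    obtain ⟨hl, hr, hd⟩ := ht
    have hs : (node l r).size = l.size + r.size := by simp [size, leaves]
    have key : ∀ A B : Finset (Fin n), ∀ c : ℝ, ∀ f : Fin n → Fin n → ℝ,
        (∀ i ∈ A, ∀ j ∈ B, f i j = c) → ∑ i ∈ A, ∑ j ∈ B, f i j = A.card * B.card * c := by
      intro A B c f h
      rw [sum_congr rfl fun i hi => sum_congr rfl (h i hi)]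
      simp [mul_assoc]
    rw [leaves_node_toFinset, sum_union (disjoint_toFinset hd)]
    simp only [sum_union (disjoint_toFinset hd), sum_add_distrib]
    have e1 : ∑ i ∈ l.leaves.toFinset, ∑ j ∈ l.leaves.toFinset, ((node l r).lcaSize i j : ℝ) =
        ∑ i ∈ l.leaves.toFinset, ∑ j ∈ l.leaves.toFinset, (l.lcaSize i j : ℝ) :=
      sum_congr rfl fun i hi => sum_congr rfl fun j hj => by
        rw [lcaSize_node_left (by simpa using hi) (by simpa using hj)]
    have e2 : ∑ i ∈ r.leaves.toFinset, ∑ j ∈ r.leaves.toFinset, ((node l r).lcaSize i j : ℝ) =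
        ∑ i ∈ r.leaves.toFinset, ∑ j ∈ r.leaves.toFinset, (r.lcaSize i j : ℝ) :=
      sum_congr rfl fun i hi => sum_congr rfl fun j hj => by
        rw [lcaSize_node_right hd (by simpa using hi) (by simpa using hj)]
    rw [e1, e2, ihl hl, ihr hr,
      key _ _ ((l.size : ℝ) + r.size) _ fun i hi j hj => by
        rw [lcaSize_node_cross hd (by simpa using hi) (by simpa using hj)]; push_cast; rfl,
      key _ _ ((l.size : ℝ) + r.size) _ fun i hi j hj => by
        rw [lcaSize_node_cross' hd (by simpa using hi) (by simpa using hj)]; push_cast; rfl,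
      card_leaves hl, card_leaves hr, hs]
    push_cast
    ring

lemma sum_max_lcaSize_sub {t : HTree n} (ht : t.leaves.Nodup) :
    ((t.size : ℝ) ^ 4 - t.size) / 12 ≤
      ∑ i ∈ t.leaves.toFinset, ∑ j ∈ t.leaves.toFinset, ∑ k ∈ t.leaves.toFinset,
        max ((t.lcaSize i k : ℝ) - t.lcaSize i j) 0 := by
  induction t with
  | leaf a => simp [leaves, lcaSize, size]
  | node l r ihl ihr =>
    simp only [leaves, List.nodup_append'] at ht
    obtain ⟨hl, hr, hd⟩ := ht
    have hs : (node l r).size = l.size + r.size := by simp [size, leaves]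
    rw [leaves_node_toFinset, sum_union (disjoint_toFinset hd)]
    simp only [sum_union (disjoint_toFinset hd), sum_add_distrib]
    have e1 : ∑ i ∈ l.leaves.toFinset, ∑ j ∈ l.leaves.toFinset, ∑ k ∈ l.leaves.toFinset,
          max (((node l r).lcaSize i k : ℝ) - (node l r).lcaSize i j) 0 =
        ∑ i ∈ l.leaves.toFinset, ∑ j ∈ l.leaves.toFinset, ∑ k ∈ l.leaves.toFinset,
          max ((l.lcaSize i k : ℝ) - l.lcaSize i j) 0 :=
      sum_congr rfl fun i hi => sum_congr rfl fun j hj => sum_congr rfl fun k hk => by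
        rw [lcaSize_node_left (i := i) (j := j) (by simpa using hi) (by simpa using hj),
          lcaSize_node_left (by simpa using hi) (by simpa using hk)]
    have e2 : ∑ i ∈ r.leaves.toFinset, ∑ j ∈ r.leaves.toFinset, ∑ k ∈ r.leaves.toFinset,
          max (((node l r).lcaSize i k : ℝ) - (node l r).lcaSize i j) 0 =
        ∑ i ∈ r.leaves.toFinset, ∑ j ∈ r.leaves.toFinset, ∑ k ∈ r.leaves.toFinset,
          max ((r.lcaSize i k : ℝ) - r.lcaSize i j) 0 :=
      sum_congr rfl fun i hi => sum_congr rfl fun j hj => sum_congr rfl fun k hk => by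
        rw [lcaSize_node_right hd (i := i) (j := j) (by simpa using hi) (by simpa using hj),
          lcaSize_node_right hd (by simpa using hi) (by simpa using hk)]
    have e3 : ∑ i ∈ l.leaves.toFinset, ∑ j ∈ l.leaves.toFinset, ∑ k ∈ r.leaves.toFinset,
          ((l.size : ℝ) + r.size - l.lcaSize i j) ≤
        ∑ i ∈ l.leaves.toFinset, ∑ j ∈ l.leaves.toFinset, ∑ k ∈ r.leaves.toFinset,
          max (((node l r).lcaSize i k : ℝ) - (node l r).lcaSize i j) 0 :=
      sum_le_sum fun i hi => sum_le_sum fun j hj => sum_le_sum fun k hk => by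
        rw [lcaSize_node_left (i := i) (j := j) (by simpa using hi) (by simpa using hj),
          lcaSize_node_cross hd (by simpa using hi) (by simpa using hk)]
        push_cast
        exact le_max_left _ _
    have e4 : ∑ i ∈ r.leaves.toFinset, ∑ j ∈ r.leaves.toFinset, ∑ k ∈ l.leaves.toFinset,
          ((l.size : ℝ) + r.size - r.lcaSize i j) ≤
        ∑ i ∈ r.leaves.toFinset, ∑ j ∈ r.leaves.toFinset, ∑ k ∈ l.leaves.toFinset,
          max (((node l r).lcaSize i k : ℝ) - (node l r).lcaSize i j) 0 :=
      sum_le_sum fun i hi => sum_le_sum fun j hj => sum_le_sum fun k hk => by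
        rw [lcaSize_node_right hd (i := i) (j := j) (by simpa using hi) (by simpa using hj),
          lcaSize_node_cross' hd (by simpa using hi) (by simpa using hk)]
        push_cast
        exact le_max_left _ _
    have nonneg : ∀ A B C : Finset (Fin n), 0 ≤ ∑ i ∈ A, ∑ j ∈ B, ∑ k ∈ C,
        max (((node l r).lcaSize i k : ℝ) - (node l r).lcaSize i j) 0 := fun A B C =>
      sum_nonneg fun i _ => sum_nonneg fun j _ => sum_nonneg fun k _ => le_max_right _ _
    simp only [sum_const, ← mul_sum, sum_sub_distrib, nsmul_eq_mul, sum_lcaSize hl,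
      sum_lcaSize hr, card_leaves hl, card_leaves hr] at e3 e4
    have n1 := nonneg l.leaves.toFinset r.leaves.toFinset l.leaves.toFinset
    have n2 := nonneg l.leaves.toFinset r.leaves.toFinset r.leaves.toFinset
    have n3 := nonneg r.leaves.toFinset l.leaves.toFinset l.leaves.toFinset
    have n4 := nonneg r.leaves.toFinset l.leaves.toFinset r.leaves.toFinset
    have f1 := ihl hl
    have f2 := ihr hr
    rw [e1, e2, hs]
    push_cast
    have ha : (1 : ℝ) ≤ l.size := by exact_mod_cast l.size_pos
    have hb : (1 : ℝ) ≤ r.size := by exact_mod_cast r.size_pos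
    have hab : (1 : ℝ) ≤ l.size * r.size := by nlinarith
    have hab2 : (l.size * r.size : ℝ) ≤ (l.size * r.size) * (l.size * r.size) := by nlinarith
    nlinarith

end HTree

section Sampling

variable {n : ℕ}

lemma IsHierarchy.toFinset_leaves {H : HTree n} (hH : IsHierarchy H) :
    H.leaves.toFinset = univ := by
  ext i; simpa using hH.2 i

lemma IsHierarchy.size_eq {H : HTree n} (hH : IsHierarchy H) : H.size = n := by
  rw [← HTree.card_leaves hH.1, hH.toFinset_leaves, card_fin]

lemma IsHierarchy.lcaSize_le {H : HTree n} (hH : IsHierarchy H) (i j : Fin n) :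
    H.lcaSize i j ≤ n :=
  (H.lcaSize_le_size i j).trans_eq hH.size_eq

lemma mem_inducedTriplets {H : HTree n} {t : Triplet n} :
    t ∈ inducedTriplets H ↔ t.1 ≠ t.2.1 ∧ t.1 ≠ t.2.2 ∧ t.2.1 ≠ t.2.2 ∧
      H.lcaSize t.1 t.2.1 < H.lcaSize t.1 t.2.2 ∧
      H.lcaSize t.1 t.2.1 < H.lcaSize t.2.1 t.2.2 := by
  simp [inducedTriplets]

lemma max_lcaSize_sub_le {H : HTree n} (hH : IsHierarchy H) (t : Triplet n) :
    max ((H.lcaSize t.1 t.2.2 : ℝ) - H.lcaSize t.1 t.2.1) 0 ≤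
      (if t ∈ inducedTriplets H then (H.lcaSize t.1 t.2.2 : ℝ) - H.lcaSize t.1 t.2.1 else 0) +
        (if t.1 = t.2.1 then (n : ℝ) else 0) := by
  obtain ⟨i, j, k⟩ := t
  have hc := hH.lcaSize_le i k
  have hc' : (H.lcaSize i k : ℝ) ≤ n := by exact_mod_cast hc
  have hn : (0 : ℝ) ≤ n := n.cast_nonneg
  have hp : (0 : ℝ) ≤ H.lcaSize i j := Nat.cast_nonneg _
  simp only
  rcases le_or_gt (H.lcaSize i k) (H.lcaSize i j) with h | h
  · have h' : (H.lcaSize i k : ℝ) ≤ H.lcaSize i j := by exact_mod_cast h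
    rw [max_eq_right (by linarith), if_neg (by rw [mem_inducedTriplets]; simp only; omega)]
    split_ifs <;> linarith
  · have h' : (H.lcaSize i j : ℝ) < H.lcaSize i k := by exact_mod_cast h
    rw [max_eq_left (by linarith)]
    by_cases hij : i = j
    · rw [if_pos hij]
      split_ifs <;> linarith
    · have hjk : j ≠ k := by rintro rfl; omega
      have hik : i ≠ k := by
        rintro rfl
        have := H.lcaSize_pos i j
        rw [HTree.lcaSize_self (hH.2 i)] at h
        omega
      have := HTree.lcaSize_trichotomy hH.1 (hH.2 i) (hH.2 j) (hH.2 k) hij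
      rw [if_pos, if_neg hij, add_zero]
      rw [mem_inducedTriplets]
      refine ⟨hij, hik, hjk, h, ?_⟩
      simp only
      omega

lemma Trev_cast (H : HTree n) (T : Finset (Triplet n)) :
    (Trev H T : ℝ) = ∑ t ∈ T, ((H.lcaSize t.1 t.2.2 : ℝ) - H.lcaSize t.1 t.2.1) := by
  simp [Trev]

lemma Trev_inducedTriplets_ge {H : HTree n} (hH : IsHierarchy H) :
    ((n : ℝ) ^ 4 - n) / 12 - (n : ℝ) ^ 3 ≤ Trev H (inducedTriplets H) := by
  have h1 := HTree.sum_max_lcaSize_sub hH.1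
  rw [hH.toFinset_leaves, hH.size_eq] at h1
  have h2 := sum_le_sum fun t (_ : t ∈ univ) => max_lcaSize_sub_le hH t
  rw [sum_add_distrib, ← sum_filter, filter_mem_eq_inter, univ_inter, ← Trev_cast] at h2
  simp only [Fintype.sum_prod_type] at h2
  have h3 : ∑ x : Fin n, ∑ y : Fin n, ∑ _z : Fin n, (if x = y then (n : ℝ) else 0) =
      (n : ℝ) ^ 3 := by
    simp; ring
  linarith

lemma card_inducedTriplets_le {H : HTree n} : 3 * (inducedTriplets H).card ≤ n ^ 3 := by
  let ρ : Triplet n ≃ Triplet n :=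
    ⟨fun t => (t.2.1, t.2.2, t.1), fun t => (t.2.2, t.1, t.2.1), fun _ => rfl, fun _ => rfl⟩
  set S := inducedTriplets H
  have hρ : ∀ t ∈ S, ρ t ∉ S ∧ ρ (ρ t) ∉ S := by
    rintro ⟨i, j, k⟩ h
    simp only [S, mem_inducedTriplets, ρ, Equiv.coe_fn_mk] at h ⊢
    rw [H.lcaSize_comm j i, H.lcaSize_comm k i, H.lcaSize_comm k j]
    omega
  have d1 : Disjoint S (S.map ρ.toEmbedding) := by
    rw [disjoint_left]
    intro t h h'
    obtain ⟨u, hu, rfl⟩ := mem_map.mp h'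
    exact (hρ u hu).1 h
  have d2 : Disjoint (S ∪ S.map ρ.toEmbedding) ((S.map ρ.toEmbedding).map ρ.toEmbedding) := by
    rw [disjoint_left]
    intro t h h'
    obtain ⟨u, hu, rfl⟩ := mem_map.mp h'
    obtain ⟨v, hv, rfl⟩ := mem_map.mp hu
    rcases mem_union.mp h with h | h
    · exact (hρ v hv).2 h
    · exact (hρ v hv).1 (by simpa using h)
  have := card_le_univ ((S ∪ S.map ρ.toEmbedding) ∪ (S.map ρ.toEmbedding).map ρ.toEmbedding)
  rw [card_union_of_disjoint d2, card_union_of_disjoint d1, card_map, card_map] at this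
  simp only [Fintype.card_prod, Fintype.card_fin, card_map] at this
  nlinarith

lemma card_inducedTriplets_ge {H : HTree n} (hH : IsHierarchy H) :
    n ^ 3 ≤ 3 * (inducedTriplets H).card + 3 * n ^ 2 := by
  let ρ : Triplet n ≃ Triplet n :=
    ⟨fun t => (t.2.1, t.2.2, t.1), fun t => (t.2.2, t.1, t.2.1), fun _ => rfl, fun _ => rfl⟩
  set S := inducedTriplets H
  let D : Finset (Triplet n) := univ.image fun q : Fin n × Fin n => (q.1, q.1, q.2)
  have hD : D.card ≤ n ^ 2 := card_image_le.trans_eq (by simp [sq])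
  let U := S ∪ D
  have hU : U.card ≤ S.card + n ^ 2 := (card_union_le _ _).trans (by omega)
  have hcover : (univ : Finset (Triplet n)) ⊆
      (U ∪ U.map ρ.toEmbedding) ∪ (U.map ρ.toEmbedding).map ρ.toEmbedding := by
    rintro ⟨i, j, k⟩ -
    have key : (i, j, k) ∈ U ∨ (k, i, j) ∈ U ∨ (j, k, i) ∈ U := by
      simp only [U, D, S, mem_union, mem_inducedTriplets, mem_image, mem_univ, true_and,
        Prod.exists, Prod.mk.injEq]
      rw [H.lcaSize_comm j i, H.lcaSize_comm k i, H.lcaSize_comm k j]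
      by_cases hij : i = j
      · exact .inl (.inr ⟨i, k, rfl, hij, rfl⟩)
      by_cases hik : i = k
      · exact .inr (.inl (.inr ⟨k, j, rfl, hik.symm, rfl⟩))
      by_cases hjk : j = k
      · exact .inr (.inr (.inr ⟨j, i, rfl, hjk, rfl⟩))
      have := HTree.lcaSize_trichotomy hH.1 (hH.2 i) (hH.2 j) (hH.2 k) hij
      have := Ne.symm hij
      have := Ne.symm hik
      have := Ne.symm hjk
      rcases ‹_ ∨ _ ∨ _› with h | h | h
      · exact .inl (.inl ⟨‹_›, ‹_›, ‹_›, by omega, by omega⟩)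
      · exact .inr (.inr (.inl ⟨‹_›, ‹_›, ‹_›, by omega, by omega⟩))
      · exact .inr (.inl (.inl ⟨‹_›, ‹_›, ‹_›, by omega, by omega⟩))
    rcases key with h | h | h
    · exact mem_union_left _ (mem_union_left _ h)
    · exact mem_union_left _ (mem_union_right _ (mem_map.mpr ⟨_, h, rfl⟩))
    · exact mem_union_right _ (mem_map.mpr ⟨_, mem_map.mpr ⟨_, h, rfl⟩, rfl⟩)
  have := card_le_card hcover
  have c1 := card_union_le (U ∪ U.map ρ.toEmbedding) ((U.map ρ.toEmbedding).map ρ.toEmbedding)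
  have c2 := card_union_le U (U.map ρ.toEmbedding)
  simp only [card_univ, Fintype.card_prod, Fintype.card_fin, card_map] at this c1 c2
  nlinarith

lemma isProbabilityMeasure_bern {p : ℝ} (hp0 : 0 ≤ p) (hp1 : p ≤ 1) :
    IsProbabilityMeasure (bern p) := by
  constructor
  simp [bern, ← ENNReal.ofReal_add hp0 (sub_nonneg.mpr hp1)]

lemma integral_bern {p : ℝ} (hp0 : 0 ≤ p) (hp1 : p ≤ 1) (f : Bool → ℝ) :
    ∫ b, f b ∂(bern p) = p * f true + (1 - p) * f false := by
  have := Measure.smul_finite (Measure.dirac true) (c := ENNReal.ofReal p) ENNReal.ofReal_ne_top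
  have := Measure.smul_finite (Measure.dirac false) (c := ENNReal.ofReal (1 - p))
    ENNReal.ofReal_ne_top
  unfold bern
  rw [integral_add_measure .of_finite .of_finite, integral_smul_measure, integral_smul_measure,
    integral_dirac, integral_dirac, ENNReal.toReal_ofReal hp0,
    ENNReal.toReal_ofReal (sub_nonneg.mpr hp1)]
  simp

/-- The centred value of a coin with success probability `p`. -/
def centred (p : ℝ) (b : Bool) : ℝ := (if b = true then 1 else 0) - p

lemma integral_exp_centred_le {p : ℝ} (hp0 : 0 ≤ p) (hp1 : p ≤ 1) {x : ℝ} (hx : |x| ≤ 1) :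
    ∫ b, Real.exp (x * centred p b) ∂(bern p) ≤ Real.exp (p * x ^ 2) := by
  have h1 := (abs_le.mp (Real.abs_exp_sub_one_sub_id_le hx)).2
  have h2 := Real.add_one_le_exp (p * (Real.exp x - 1))
  have e1 : Real.exp (x * (1 - p)) = Real.exp (-(p * x)) * Real.exp x := by
    rw [← Real.exp_add]; ring_nf
  calc ∫ b, Real.exp (x * centred p b) ∂(bern p)
      = Real.exp (-(p * x)) * (p * (Real.exp x - 1) + 1) := by
        rw [integral_bern hp0 hp1]
        simp only [centred, if_true, Bool.false_eq_true, if_false, e1]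
        rw [show x * (0 - p) = -(p * x) by ring]
        ring
    _ ≤ Real.exp (-(p * x)) * Real.exp (p * (Real.exp x - 1)) := by gcongr
    _ = Real.exp (p * (Real.exp x - 1 - x)) := by rw [← Real.exp_add]; ring_nf
    _ ≤ Real.exp (p * x ^ 2) := by gcongr

/-- Chernoff bound for a weighted sum of independent centred coins. -/
lemma measure_pi_bern_le {ι : Type*} [Fintype ι] {p : ℝ} (hp0 : 0 ≤ p) (hp1 : p ≤ 1)
    (c : ι → ℝ) {l : ℝ} (hl : 0 ≤ l) (hc : ∀ u, |l * c u| ≤ 1) (s : ℝ) :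
    (Measure.pi fun _ : ι => bern p).real {ω | s ≤ ∑ u, c u * centred p (ω u)} ≤
      Real.exp (-l * s + l ^ 2 * p * ∑ u, c u ^ 2) := by
  have := isProbabilityMeasure_bern hp0 hp1
  refine (ProbabilityTheory.measure_ge_le_exp_mul_mgf s hl .of_finite).trans ?_
  rw [Real.exp_add]
  gcongr
  unfold ProbabilityTheory.mgf
  have : ∀ ω : ι → Bool, Real.exp (l * ∑ u, c u * centred p (ω u)) =
      ∏ u, Real.exp (l * c u * centred p (ω u)) := fun ω => by
    rw [← Real.exp_sum, mul_sum]
    simp only [mul_assoc]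
  simp only [this]
  rw [integral_fintype_prod_eq_prod (fun u b => Real.exp (l * c u * centred p b))]
  calc ∏ u, ∫ b, Real.exp (l * c u * centred p b) ∂(bern p)
      ≤ ∏ u, Real.exp (p * (l * c u) ^ 2) :=
        prod_le_prod (fun u _ => integral_nonneg fun b => (Real.exp_pos _).le)
          fun u _ => integral_exp_centred_le hp0 hp1 (hc u)
    _ = Real.exp (l ^ 2 * p * ∑ u, c u ^ 2) := by
        rw [← Real.exp_sum, mul_sum]
        congr 1
        exact sum_congr rfl fun u _ => by ring

/-- The total weight of the triplets of `T0` that share the coin `u`. -/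
def fiberWeight (H : HTree n) (g : Triplet n → ℝ) (u : Triplet n) : ℝ :=
  ∑ t ∈ inducedTriplets H with pairKey t = u, g t

lemma sum_sampledT_sub (H : HTree n) (g : Triplet n → ℝ) (p : ℝ) (ω : Triplet n → Bool) :
    ∑ t ∈ sampledT H ω, g t - p * ∑ t ∈ inducedTriplets H, g t =
      ∑ u, fiberWeight H g u * centred p (ω u) := by
  have h : ∀ u, fiberWeight H g u * centred p (ω u) =
      ∑ t ∈ inducedTriplets H with pairKey t = u, g t * centred p (ω (pairKey t)) := fun u => by
    rw [fiberWeight, sum_mul]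
    exact sum_congr rfl fun t ht => by rw [(mem_filter.mp ht).2]
  simp only [h]
  rw [sum_fiberwise, sampledT, sum_filter, mul_sum, ← sum_sub_distrib]
  refine sum_congr rfl fun t _ => ?_
  unfold centred
  split_ifs <;> ring

lemma card_fiber_le (H : HTree n) (u : Triplet n) :
    ((inducedTriplets H).filter fun t => pairKey t = u).card ≤ 2 := by
  refine (card_le_card (t := {u, (u.2.1, u.1, u.2.2)}) ?_).trans card_le_two
  rintro ⟨i, j, k⟩ h
  rw [mem_filter] at h
  rw [← h.2, mem_insert, mem_singleton]
  rcases le_total i j with hij | hij <;> simp [pairKey, hij]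

lemma abs_fiberWeight_le (H : HTree n) {g : Triplet n → ℝ} {M : ℝ} (hM : 0 ≤ M)
    (hg : ∀ t, |g t| ≤ M) (u : Triplet n) : |fiberWeight H g u| ≤ 2 * M := by
  refine (abs_sum_le_sum_abs _ _).trans ((sum_le_card_nsmul _ _ M fun t _ => hg t).trans ?_)
  rw [nsmul_eq_mul]
  gcongr
  exact_mod_cast card_fiber_le H u

lemma sum_fiberWeight_sq_le (H : HTree n) {g : Triplet n → ℝ} {M : ℝ} (hM : 0 ≤ M)
    (hg : ∀ t, |g t| ≤ M) : ∑ u, fiberWeight H g u ^ 2 ≤ 2 / 3 * M ^ 2 * (n : ℝ) ^ 3 := by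
  have h1 : ∑ u, |fiberWeight H g u| ≤ (inducedTriplets H).card * M := by
    calc ∑ u, |fiberWeight H g u|
        ≤ ∑ u, ∑ t ∈ inducedTriplets H with pairKey t = u, |g t| :=
          sum_le_sum fun u _ => abs_sum_le_sum_abs _ _
      _ = ∑ t ∈ inducedTriplets H, |g t| := sum_fiberwise _ _ _
      _ ≤ (inducedTriplets H).card * M := by
          simpa using sum_le_card_nsmul _ _ M fun t (_ : t ∈ inducedTriplets H) => hg t
  have h2 : (3 * (inducedTriplets H).card : ℝ) ≤ (n : ℝ) ^ 3 := by
    exact_mod_cast card_inducedTriplets_le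
  calc ∑ u, fiberWeight H g u ^ 2
      ≤ ∑ u, 2 * M * |fiberWeight H g u| := sum_le_sum fun u _ => by
        rw [← sq_abs, sq]
        exact mul_le_mul_of_nonneg_right (abs_fiberWeight_le H hM hg u) (abs_nonneg _)
    _ = 2 * M * ∑ u, |fiberWeight H g u| := by rw [mul_sum]
    _ ≤ 2 * M * ((inducedTriplets H).card * M) := by gcongr
    _ = 2 / 3 * M ^ 2 * (3 * (inducedTriplets H).card) := by ring
    _ ≤ 2 / 3 * M ^ 2 * (n : ℝ) ^ 3 := by gcongr

lemma sampleMeasure_upper_tail (H : HTree n) {p : ℝ} (hp0 : 0 ≤ p) (hp1 : p ≤ 1)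
    {g : Triplet n → ℝ} {M : ℝ} (hM : 0 < M) (hg : ∀ t, |g t| ≤ M) {θ : ℝ}
    (hθ0 : 0 ≤ θ) (hθ1 : θ ≤ 1) :
    (sampleMeasure n p).real {ω | θ * p * (n : ℝ) ^ 3 * M ≤
        ∑ t ∈ sampledT H ω, g t - p * ∑ t ∈ inducedTriplets H, g t} ≤
      Real.exp (-(p * (n : ℝ) ^ 3 * θ ^ 2 / 3)) := by
  simp only [sum_sampledT_sub]
  have hl : 0 ≤ θ / (2 * M) := by positivity
  refine (measure_pi_bern_le hp0 hp1 _ hl (fun u => ?_) _).trans (Real.exp_le_exp.mpr ?_)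
  · rw [abs_mul, abs_of_nonneg hl]
    calc θ / (2 * M) * |fiberWeight H g u| ≤ θ / (2 * M) * (2 * M) := by
          gcongr
          exact abs_fiberWeight_le H hM.le hg u
      _ = θ := by field_simp
      _ ≤ 1 := hθ1
  · calc -(θ / (2 * M)) * (θ * p * (n : ℝ) ^ 3 * M) +
          (θ / (2 * M)) ^ 2 * p * ∑ u, fiberWeight H g u ^ 2
        ≤ -(θ / (2 * M)) * (θ * p * (n : ℝ) ^ 3 * M) +
          (θ / (2 * M)) ^ 2 * p * (2 / 3 * M ^ 2 * (n : ℝ) ^ 3) := by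
          gcongr
          exact sum_fiberWeight_sq_le H hM.le hg
      _ = -(p * (n : ℝ) ^ 3 * θ ^ 2 / 3) := by field_simp; ring

/-- The event that the sampled sum of `g` is far from `p` times its sum over `T0`. -/
def deviates (H : HTree n) (p r : ℝ) (g : Triplet n → ℝ) : Set (Triplet n → Bool) :=
  {ω | r ≤ |∑ t ∈ sampledT H ω, g t - p * ∑ t ∈ inducedTriplets H, g t|}

lemma sampleMeasure_deviates_le (H : HTree n) {p : ℝ} (hp0 : 0 ≤ p) (hp1 : p ≤ 1)
    {g : Triplet n → ℝ} {M : ℝ} (hM : 0 < M) (hg : ∀ t, |g t| ≤ M) {θ : ℝ}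
    (hθ0 : 0 ≤ θ) (hθ1 : θ ≤ 1) :
    (sampleMeasure n p).real (deviates H p (θ * p * (n : ℝ) ^ 3 * M) g) ≤
      2 * Real.exp (-(p * (n : ℝ) ^ 3 * θ ^ 2 / 3)) := by
  have := isProbabilityMeasure_bern hp0 hp1
  have : IsProbabilityMeasure (sampleMeasure n p) := by unfold sampleMeasure; infer_instance
  have h1 := sampleMeasure_upper_tail H hp0 hp1 hM hg hθ0 hθ1
  have h2 := sampleMeasure_upper_tail H (g := fun t => -g t) hp0 hp1 hM
    (fun t => (abs_neg _).trans_le (hg t)) hθ0 hθ1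
  rw [two_mul]
  refine (measureReal_mono (fun ω hω => ?_)).trans
    ((measureReal_union_le _ _).trans (add_le_add h1 h2))
  simp only [deviates, Set.mem_ofPred_eq] at hω
  rcases le_abs.mp hω with h | h
  · exact .inl h
  · refine .inr (h.trans_eq ?_)
    simp only [sum_neg_distrib]
    ring

/-- The score of a triplet under a table of subtree sizes. -/
def tableScore (f : Fin n → Fin n → Fin (n + 1)) (t : Triplet n) : ℝ :=
  ((f t.1 t.2.2 : ℕ) : ℝ) - (f t.1 t.2.1 : ℕ)

lemma abs_tableScore_le (f : Fin n → Fin n → Fin (n + 1)) (t : Triplet n) :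
    |tableScore f t| ≤ n := by
  have h1 : ((f t.1 t.2.2 : ℕ) : ℝ) ≤ n := by exact_mod_cast (f t.1 t.2.2).is_le
  have h2 : ((f t.1 t.2.1 : ℕ) : ℝ) ≤ n := by exact_mod_cast (f t.1 t.2.1).is_le
  have h3 : (0 : ℝ) ≤ (f t.1 t.2.2 : ℕ) := Nat.cast_nonneg _
  have h4 : (0 : ℝ) ≤ (f t.1 t.2.1 : ℕ) := Nat.cast_nonneg _
  rw [tableScore, abs_le]
  constructor <;> linarith

/-- Every hierarchy is described by a table of subtree sizes. -/
lemma IsHierarchy.exists_tableScore {H : HTree n} (hH : IsHierarchy H) :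
    ∃ f, ∀ T : Finset (Triplet n), (Trev H T : ℝ) = ∑ t ∈ T, tableScore f t :=
  ⟨fun i j => ⟨H.lcaSize i j, Nat.lt_succ_of_le (hH.lcaSize_le i j)⟩, fun T => Trev_cast H T⟩

/-- The sampled counts are off for the number of triplets or for some table of subtree sizes. -/
def badEvent (H : HTree n) (p θ : ℝ) : Set (Triplet n → Bool) :=
  deviates H p (θ * p * (n : ℝ) ^ 3 * 1) (fun _ => 1) ∪
    ⋃ f : Fin n → Fin n → Fin (n + 1), deviates H p (θ * p * (n : ℝ) ^ 3 * n) (tableScore f)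

lemma sampleMeasure_badEvent_le (H : HTree n) (hn : 0 < n) {p : ℝ} (hp0 : 0 ≤ p) (hp1 : p ≤ 1)
    {θ : ℝ} (hθ0 : 0 ≤ θ) (hθ1 : θ ≤ 1) :
    (sampleMeasure n p).real (badEvent H p θ) ≤
      (1 + (n + 1 : ℝ) ^ (n ^ 2)) * (2 * Real.exp (-(p * (n : ℝ) ^ 3 * θ ^ 2 / 3))) := by
  have := isProbabilityMeasure_bern hp0 hp1
  have : IsProbabilityMeasure (sampleMeasure n p) := by unfold sampleMeasure; infer_instance
  rw [add_mul, one_mul]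
  refine (measureReal_union_le _ _).trans (add_le_add
    (sampleMeasure_deviates_le H hp0 hp1 one_pos (by simp) hθ0 hθ1) ?_)
  refine (measureReal_iUnion_fintype_le _).trans ?_
  refine (sum_le_card_nsmul _ _ _ fun f _ => sampleMeasure_deviates_le H hp0 hp1
    (by exact_mod_cast hn) (abs_tableScore_le f) hθ0 hθ1).trans_eq ?_
  simp [← pow_mul, sq]

/-- Outside the bad event, maximizing the sampled revenue nearly maximizes the full revenue. -/
lemma good_of_notMem_badEvent {H0 : HTree n} (hH0 : IsHierarchy H0) (hn : 100 ≤ n) {p ε : ℝ}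
    (hp0 : 0 < p) (hε0 : 0 < ε) (hε : ε < 1 / 2) {ω : Triplet n → Bool}
    (hω : ω ∉ badEvent H0 p (ε / 30)) :
    (0.1 * p * (n : ℝ) ^ 3 ≤ ((sampledT H0 ω).card : ℝ) ∧
      ((sampledT H0 ω).card : ℝ) ≤ 0.5 * p * (n : ℝ) ^ 3) ∧
    ∀ Hhat : HTree n, IsHierarchy Hhat →
      (∀ H : HTree n, IsHierarchy H →
        Trev H (sampledT H0 ω) ≤ Trev Hhat (sampledT H0 ω)) →
      (1 - ε) * (Trev H0 (inducedTriplets H0) : ℝ) ≤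
        (Trev Hhat (inducedTriplets H0) : ℝ) := by
  have hn' : (100 : ℝ) ≤ n := by exact_mod_cast hn
  simp only [badEvent, deviates, Set.mem_union, Set.mem_iUnion, Set.mem_ofPred_eq, not_or,
    not_exists, not_le, sum_const, nsmul_eq_mul, mul_one] at hω
  obtain ⟨h1, h2⟩ := hω
  have hn3 : (0 : ℝ) < p * (n : ℝ) ^ 3 := by positivity
  constructor
  · rw [abs_lt] at h1
    have c1 : (3 * (inducedTriplets H0).card : ℝ) ≤ (n : ℝ) ^ 3 := by
      exact_mod_cast card_inducedTriplets_le
    have c2 : (n : ℝ) ^ 3 ≤ 3 * (inducedTriplets H0).card + 3 * (n : ℝ) ^ 2 := by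
      exact_mod_cast card_inducedTriplets_ge hH0
    have c3 : 3 * (n : ℝ) ^ 2 ≤ 3 / 100 * (n : ℝ) ^ 3 := by nlinarith [sq_nonneg (n : ℝ)]
    have d1 := mul_le_mul_of_nonneg_left c1 hp0.le
    have d2 : p * (0.97 * (n : ℝ) ^ 3) ≤ p * (3 * (inducedTriplets H0).card) :=
      mul_le_mul_of_nonneg_left (by linarith) hp0.le
    have d3 : ε * (p * (n : ℝ) ^ 3) ≤ 1 / 2 * (p * (n : ℝ) ^ 3) := by gcongr
    constructor <;> linarith
  · intro Hhat hhat hmax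
    obtain ⟨f, hf⟩ := hhat.exists_tableScore
    obtain ⟨f0, hf0⟩ := hH0.exists_tableScore
    have a1 := abs_lt.mp (h2 f)
    have a2 := abs_lt.mp (h2 f0)
    rw [← hf, ← hf] at a1
    rw [← hf0, ← hf0] at a2
    have hm : (Trev H0 (sampledT H0 ω) : ℝ) ≤ Trev Hhat (sampledT H0 ω) := by
      exact_mod_cast hmax H0 hH0
    have hr := Trev_inducedTriplets_ge hH0
    have hq : (n : ℝ) ^ 4 / 15 ≤ Trev H0 (inducedTriplets H0) := by
      have : 100 * (n : ℝ) ^ 3 ≤ (n : ℝ) ^ 4 := by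
        rw [pow_succ _ 3, mul_comm]; gcongr
      have : (n : ℝ) ≤ (n : ℝ) ^ 3 := le_self_pow₀ (by linarith) (by norm_num)
      linarith
    have hq' := mul_le_mul_of_nonneg_left hq (by positivity : 0 ≤ p * ε)
    refine le_of_mul_le_mul_left ?_ hp0
    nlinarith

lemma union_bound_le {p α ε : ℝ} (hn : 100 ≤ n) (hα : 0 < α) (hε0 : 0 < ε)
    (hpn : p > 2 ^ 12 * (α + 2) * Real.log n / ((n : ℝ) * ε ^ 2)) :
    (1 + (n + 1 : ℝ) ^ (n ^ 2)) * (2 * Real.exp (-(p * (n : ℝ) ^ 3 * (ε / 30) ^ 2 / 3))) ≤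
      2 * (n : ℝ) ^ (-α) := by
  have hn' : (100 : ℝ) ≤ n := by exact_mod_cast hn
  have hn0 : (0 : ℝ) < n := by linarith
  set L := Real.log n with hL
  have hL1 : 1 ≤ L := by
    rw [hL, Real.le_log_iff_exp_le hn0]
    linarith [Real.exp_one_lt_d9]
  have hcount : 1 + (n + 1 : ℝ) ^ (n ^ 2) ≤ Real.exp (1 + 2 * (n : ℝ) ^ 2 * L) := by
    have h1 : (n + 1 : ℝ) ^ (n ^ 2) ≤ Real.exp (2 * (n : ℝ) ^ 2 * L) := by
      calc (n + 1 : ℝ) ^ (n ^ 2) ≤ ((n : ℝ) ^ 2) ^ (n ^ 2) := by gcongr; nlinarith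
        _ = Real.exp (2 * (n : ℝ) ^ 2 * L) := by
          rw [← pow_mul, ← Real.exp_log (pow_pos hn0 _), Real.log_pow]
          push_cast
          rfl
    have h2 : 1 ≤ (n + 1 : ℝ) ^ (n ^ 2) := one_le_pow₀ (by linarith)
    have h3 : 2 ≤ Real.exp 1 := by linarith [Real.exp_one_gt_d9]
    rw [Real.exp_add]
    nlinarith [Real.exp_pos (2 * (n : ℝ) ^ 2 * L)]
  have hexp : 3 / 2 * (α + 2) * L * (n : ℝ) ^ 2 ≤ p * (n : ℝ) ^ 3 * (ε / 30) ^ 2 / 3 := by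
    rw [gt_iff_lt, div_lt_iff₀ (by positivity)] at hpn
    have := mul_le_mul_of_nonneg_right hpn.le (sq_nonneg (n : ℝ))
    have : 0 ≤ (α + 2) * L * (n : ℝ) ^ 2 := by positivity
    linarith
  rw [Real.rpow_def_of_pos hn0, ← hL]
  calc (1 + (n + 1 : ℝ) ^ (n ^ 2)) * (2 * Real.exp (-(p * (n : ℝ) ^ 3 * (ε / 30) ^ 2 / 3)))
      ≤ Real.exp (1 + 2 * (n : ℝ) ^ 2 * L) *
          (2 * Real.exp (-(3 / 2 * (α + 2) * L * (n : ℝ) ^ 2))) := by gcongr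
    _ = 2 * Real.exp (1 + 2 * (n : ℝ) ^ 2 * L - 3 / 2 * (α + 2) * L * (n : ℝ) ^ 2) := by
        rw [sub_eq_add_neg, Real.exp_add _ (-_)]
        ring
    _ ≤ 2 * Real.exp (L * -α) := by
        gcongr
        have h1 : (1 : ℝ) ≤ (n : ℝ) ^ 2 := one_le_pow₀ (by linarith)
        have h2 : 1 ≤ L * (n : ℝ) ^ 2 := by nlinarith
        have h3 : α * L ≤ α * L * (n : ℝ) ^ 2 := le_mul_of_one_le_right (by positivity) h1
        have h4 : 0 ≤ α * L * (n : ℝ) ^ 2 := by positivity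
        linarith

lemma hundred_le_of_sampling_rate {p α ε : ℝ} (hp1 : p ≤ 1) (hα : 0 < α) (hε0 : 0 < ε)
    (hε : ε < 1 / 2) (hn : (n : ℝ) > 8 / ε)
    (hpn : p > 2 ^ 12 * (α + 2) * Real.log n / ((n : ℝ) * ε ^ 2)) : 100 ≤ n := by
  have hn16 : (16 : ℝ) < n := by
    refine lt_trans ?_ hn
    rw [lt_div_iff₀ hε0]
    linarith
  have hL1 : 1 ≤ Real.log n := by
    rw [Real.le_log_iff_exp_le (by linarith)]
    linarith [Real.exp_one_lt_d9]
  have h := hpn.lt.trans_le hp1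
  rw [div_lt_one (by positivity)] at h
  have h1 : 2 * 1 ≤ (α + 2) * Real.log n := by gcongr; linarith
  have h2 : (n : ℝ) * ε ^ 2 ≤ n * 1 := by gcongr; nlinarith
  have h3 : (100 : ℝ) ≤ n := by linarith
  exact_mod_cast h3

end Sampling

/-- with probability `≥ 1 − 2n^{−α}`, both `0.1·p·n³ ≤ |T| ≤ 0.5·p·n³` and, for
every hierarchy `Ĥ` maximizing `Trev(·, T)`, `Trev(Ĥ, T0) ≥ (1−ε)·Trev(H0, T0)`. -/
theorem sampled_trev_approximation {n : ℕ} (H0 : HTree n) (hH0 : IsHierarchy H0)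
    (p : ℝ) (hp0 : 0 < p) (hp1 : p ≤ 1) (α ε : ℝ) (hα : 0 < α)
    (hε0 : 0 < ε) (hε : ε < 1 / 2) (hn : (n : ℝ) > 8 / ε)
    (hpn : p > 2 ^ 12 * (α + 2) * Real.log n / ((n : ℝ) * ε ^ 2)) :
    ENNReal.ofReal (1 - 2 * (n : ℝ) ^ (-α)) ≤
      sampleMeasure n p {ω |
        (0.1 * p * (n : ℝ) ^ 3 ≤ ((sampledT H0 ω).card : ℝ) ∧
          ((sampledT H0 ω).card : ℝ) ≤ 0.5 * p * (n : ℝ) ^ 3) ∧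
        ∀ Hhat : HTree n, IsHierarchy Hhat →
          (∀ H : HTree n, IsHierarchy H →
            Trev H (sampledT H0 ω) ≤ Trev Hhat (sampledT H0 ω)) →
          (1 - ε) * (Trev H0 (inducedTriplets H0) : ℝ) ≤
            (Trev Hhat (inducedTriplets H0) : ℝ)} := by
  have hn100 := hundred_le_of_sampling_rate hp1 hα hε0 hε hn hpn
  have : IsProbabilityMeasure (bern p) := isProbabilityMeasure_bern hp0.le hp1
  have : IsProbabilityMeasure (sampleMeasure n p) := by unfold sampleMeasure; infer_instance
  have hbad := (sampleMeasure_badEvent_le H0 (by omega) hp0.le hp1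
    (by positivity : 0 ≤ ε / 30) (by linarith)).trans (union_bound_le hn100 hα hε0 hpn)
  have hcompl := probReal_compl_eq_one_sub (μ := sampleMeasure n p)
    (s := badEvent H0 p (ε / 30)) (Set.toFinite _).measurableSet
  refine ENNReal.ofReal_le_of_le_toReal
    ((by linarith : _ ≤ (sampleMeasure n p).real (badEvent H0 p (ε / 30))ᶜ).trans ?_)
  exact measureReal_mono fun ω hω => good_of_notMem_badEvent hH0 hn100 hp0 hε0 hε hω

end CompHC
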